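/- arXiv:2405.08338 — 2 statements merged into one kernel-verified Lean document; each statement's English description precedes it below -/
import Mathlib

section
/- Let (a,b,c) ∈ ℝ³. The following are equivalent: (i) for every z₀ ∈ ℂ there exists r ∈ ℝ such that Re(z²·conj z·(2a·conj z₀ + 3b·z₀)) − 3c·Im(z²·conj z·z₀) = r·Re(z²·conj z) for all z ∈ ℂ; (ii) 2a = 3b and c = 0, i.e. (a,b,c) is a real multiple of (3,2,0). -/
open Complex ComplexConjugate

/-- Homogeneity obstruction for the model surface `Q_{a,b,c}`:
the term `Re(z²·conj z·(2a·conj z₀ + 3b·z₀)) − 3c·Im(z²·conj z·z₀)` is a real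
multiple of `Re(z²·conj z)` for every `z₀` iff `2a = 3b` and `c = 0`,
i.e. `(a,b,c)` is a real multiple of `(3,2,0)`. -/
theorem homogeneity_obstruction (a b c : ℝ) :
    (∀ z₀ : ℂ, ∃ r : ℝ, ∀ z : ℂ,
        (z ^ 2 * conj z * (2 * (a : ℂ) * conj z₀ + 3 * (b : ℂ) * z₀)).re
          - 3 * c * (z ^ 2 * conj z * z₀).im
        = r * (z ^ 2 * conj z).re)
    ↔ (2 * a = 3 * b ∧ c = 0) := by
  constructor
  · intro h
    obtain ⟨r, hr⟩ := h I
    obtain ⟨s, hs⟩ := h 1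
    have hab := hr I
    have hc := hs I
    simp [pow_two] at hab hc
    exact ⟨by linarith, hc⟩
  · rintro ⟨hab, rfl⟩ z₀
    refine ⟨(2 * a + 3 * b) * z₀.re, fun z => ?_⟩
    simp only [pow_two, mul_re, mul_im, add_re, add_im, conj_re, conj_im, ofReal_re, ofReal_im,
      re_ofNat, im_ofNat]
    linear_combination (z.im * z₀.im * (z.re ^ 2 + z.im ^ 2)) * hab
end

section
/- For real numbers x, y, u₂, v₂, u₃, v₃, u₄, v₄, consider the real 6×8 matrix M with rows r₁ = (x, y, 2u₂, 2v₂, 3u₃, 3v₃, 4u₄, 4v₄), r₂ = (0,0,1,0,0,0,0,0), r₃ = (0,0,0,0,1,0,0,0), r₄ = (0,0,0,0,0,0,1,0), r₅ = (1, 0, −2y, 2x, 4u₂ − 4xy, 2(2v₂ + x² − y²), 4(3u₃ − 3x²y + y³), 4(3v₃ + x³ − xy²)), r₆ = (0, 1, 2x, 2y, 2(x² − y²), 4xy, 4(x³ − 3xy²), 4(3x²y − y³)). Then rank M ≥ 5 for all values of the variables, and rank M = 6 if and only if (v₂, v₃, v₄) ≠ (x² + y², 2x(x² + y²), 7x⁴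 + 8x²y² − y⁴). -/
/-- The 6×8 real matrix formed by the six vector fields generating the Lie
algebra of the automorphism group of the homogeneous model surface, evaluated
at the point with real coordinates `(x, y, u₂, v₂, u₃, v₃, u₄, v₄)`. -/
def orbitMatrix (x y u2 v2 u3 v3 u4 v4 : ℝ) : Matrix (Fin 6) (Fin 8) ℝ :=
  !![x, y, 2*u2, 2*v2, 3*u3, 3*v3, 4*u4, 4*v4;
     0, 0, 1, 0, 0, 0, 0, 0;
     0, 0, 0, 0, 1, 0, 0, 0;
     0, 0, 0, 0, 0, 0, 1, 0;
     1, 0, -2*y, 2*x, 4*u2 - 4*x*y, 2*(2*v2 + x^2 - y^2),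
       4*(3*u3 - 3*x^2*y + y^3), 4*(3*v3 + x^3 - x*y^2);
     0, 1, 2*x, 2*y, 2*(x^2 - y^2), 4*x*y, 4*(x^3 - 3*x*y^2), 4*(3*x^2*y - y^3)]

theorem Matrix.rank_eq_card_iff_linearIndependent_row {m n K : Type*} [Fintype m] [Fintype n]
    [Field K] (A : Matrix m n K) : A.rank = Fintype.card m ↔ LinearIndependent K A.row := by
  rw [linearIndependent_iff_card_eq_finrank_span, A.rank_eq_finrank_span_row, Set.finrank]
  exact eq_comm

theorem five_le_rank_orbitMatrix (x y u2 v2 u3 v3 u4 v4 : ℝ) :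
    5 ≤ (orbitMatrix x y u2 v2 u3 v3 u4 v4).rank := by
  have h : LinearIndependent ℝ
      ((orbitMatrix x y u2 v2 u3 v3 u4 v4).submatrix Fin.succ id).row := by
    rw [Fintype.linearIndependent_iff]
    intro g hg
    have hcol := fun j => congrFun hg j
    simp only [Finset.sum_apply, Pi.smul_apply, Pi.zero_apply, Fin.sum_univ_succ,
      Fin.forall_fin_succ] at hcol
    simp [orbitMatrix, Matrix.row] at hcol
    simp only [Fin.forall_fin_succ]
    simp
    grind
  simpa [h.rank_matrix] using
    (orbitMatrix x y u2 v2 u3 v3 u4 v4).rank_submatrix_le Fin.succ id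

theorem linearIndependent_row_orbitMatrix_iff (x y u2 v2 u3 v3 u4 v4 : ℝ) :
    LinearIndependent ℝ (orbitMatrix x y u2 v2 u3 v3 u4 v4).row ↔
      (v2, v3, v4) ≠ (x^2 + y^2, 2*x*(x^2 + y^2), 7*x^4 + 8*x^2*y^2 - y^4) := by
  rw [Fintype.linearIndependent_iff]
  constructor
  · intro h heq
    simp only [Prod.mk.injEq] at heq
    obtain ⟨rfl, rfl, rfl⟩ := heq
    have h0 := h ![1, -2*u2, -3*u3 + x*(4*u2 - 4*x*y) + 2*y*(x^2 - y^2),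
      -4*u4 + 4*x*(3*u3 - 3*x^2*y + y^3) + 4*y*(x^3 - 3*x*y^2), -x, -y] ?_ 0
    · simp at h0
    · ext j
      fin_cases j <;> simp [orbitMatrix, Matrix.row, Fin.sum_univ_succ] <;> ring
  · intro hne g hg
    have hcol := fun j => congrFun hg j
    simp only [Finset.sum_apply, Pi.smul_apply, Pi.zero_apply, Fin.sum_univ_succ,
      Fin.forall_fin_succ] at hcol
    simp [orbitMatrix, Matrix.row] at hcol
    obtain ⟨hx, hy, hu2, hv2, hu3, hv3, hu4, hv4⟩ := hcol
    have h4 : g 4 = -(g 0 * x) := by linear_combination hx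
    have h5 : g 5 = -(g 0 * y) := by linear_combination hy
    have h0 : g 0 = 0 := by
      by_contra hg0
      apply hne
      rw [h4, h5] at hv2 hv3 hv4
      obtain rfl : v2 = x^2 + y^2 := mul_left_cancel₀ hg0 (by linear_combination hv2 / 2)
      obtain rfl : v3 = 2*x*(x^2 + y^2) := mul_left_cancel₀ hg0 (by linear_combination hv3 / 3)
      obtain rfl : v4 = 7*x^4 + 8*x^2*y^2 - y^4 :=
        mul_left_cancel₀ hg0 (by linear_combination hv4 / 4)
      rfl
    simp only [h0, zero_mul, neg_zero] at h4 h5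
    simp only [h0, h4, h5, zero_mul, neg_zero, zero_add, add_zero] at hu2 hu3 hu4
    intro i
    fin_cases i <;> assumption

theorem orbitMatrix_rank (x y u2 v2 u3 v3 u4 v4 : ℝ) :
    5 ≤ (orbitMatrix x y u2 v2 u3 v3 u4 v4).rank ∧
    ((orbitMatrix x y u2 v2 u3 v3 u4 v4).rank = 6 ↔
      (v2, v3, v4) ≠ (x^2 + y^2, 2*x*(x^2 + y^2), 7*x^4 + 8*x^2*y^2 - y^4)) := by
  refine ⟨five_le_rank_orbitMatrix .., ?_⟩
  rw [← linearIndependent_row_orbitMatrix_iff x y u2 v2 u3 v3 u4 v4,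
    ← Matrix.rank_eq_card_iff_linearIndependent_row, Fintype.card_fin]
end
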